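/- Let p > 1. There exists a constant C = C(p) > 0 such that for every c > 0, ∫₀¹ ((c²w² + 1)^{p/2} · (1-w)^{1/2})^{-1} dw ≤ C / c. -/

import Mathlib

noncomputable section

open MeasureTheory

/-- A pointwise bound which separates the decay in `c * w` from the singularity at `w = 1`. -/
lemma inv_rpow_mul_rpow_le {p c w : ℝ} (hp : 1 ≤ p) (hc : 0 < c) (hw0 : 0 < w) (hw1 : w ≤ 1) :
    ((c ^ 2 * w ^ 2 + 1) ^ (p / 2) * (1 - w) ^ ((1 : ℝ) / 2))⁻¹ ≤
      2 * (1 + (c * w) ^ 2) ^ (-p / 2) + 2 / c * (1 - w) ^ (-(1 / 2) : ℝ) := by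
  have hbase : (c ^ 2 * w ^ 2 + 1) = 1 + (c * w) ^ 2 := by ring
  have hpos : 0 < 1 + (c * w) ^ 2 := by positivity
  have h1w : 0 ≤ 1 - w := by linarith
  rw [hbase, mul_inv, ← Real.rpow_neg hpos.le, ← Real.rpow_neg h1w, ← neg_div]
  set A := (1 + (c * w) ^ 2) ^ (-p / 2) with hA
  have hA0 : 0 ≤ A := by positivity
  have hB0 : 0 ≤ (1 - w) ^ (-(1 / 2) : ℝ) := by positivity
  rcases le_total w (1 / 2) with h | h
  · have hB : (1 - w) ^ (-(1 / 2) : ℝ) ≤ 2 := by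
      calc (1 - w) ^ (-(1 / 2) : ℝ) ≤ (1 - w) ^ (-1 : ℝ) :=
            Real.rpow_le_rpow_of_exponent_ge (by linarith) (by linarith) (by norm_num)
        _ = (1 - w)⁻¹ := Real.rpow_neg_one _
        _ ≤ (1 / 2)⁻¹ := inv_anti₀ (by norm_num) (by linarith)
        _ = 2 := by norm_num
    have : 0 ≤ 2 / c * (1 - w) ^ (-(1 / 2) : ℝ) := by positivity
    nlinarith [mul_le_mul_of_nonneg_left hB hA0]
  · have hAc : A ≤ 2 / c := by
      calc A ≤ (1 + (c * w) ^ 2) ^ (-(1 / 2) : ℝ) :=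
            Real.rpow_le_rpow_of_exponent_le (by nlinarith [sq_nonneg (c * w)]) (by linarith)
        _ = (√(1 + (c * w) ^ 2))⁻¹ := by rw [Real.rpow_neg hpos.le, ← Real.sqrt_eq_rpow]
        _ ≤ (c / 2)⁻¹ := by
            refine inv_anti₀ (by positivity) (Real.le_sqrt_of_sq_le ?_)
            nlinarith [mul_le_mul_of_nonneg_left h hc.le]
        _ = 2 / c := by rw [inv_div]
    have := mul_le_mul_of_nonneg_right hAc hB0
    linarith

lemma integrable_one_add_sq_rpow {p : ℝ} (hp : 1 < p) :
    Integrable fun x : ℝ ↦ (1 + x ^ 2) ^ (-p / 2) := by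
  simpa using integrable_rpow_neg_one_add_norm_sq (E := ℝ) (μ := volume) (r := p) (by simpa using hp)

lemma integral_one_add_mul_sq_rpow_le {p c : ℝ} (hp : 1 < p) (hc : 0 < c) :
    ∫ w in (0 : ℝ)..1, (1 + (c * w) ^ 2) ^ (-p / 2) ≤ (∫ x : ℝ, (1 + x ^ 2) ^ (-p / 2)) / c := by
  rw [intervalIntegral.integral_comp_mul_left (fun x ↦ (1 + x ^ 2) ^ (-p / 2)) hc.ne', smul_eq_mul,
    mul_zero, mul_one, intervalIntegral.integral_of_le hc.le, inv_mul_eq_div]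
  exact div_le_div_of_nonneg_right (setIntegral_le_integral (integrable_one_add_sq_rpow hp)
    (Filter.Eventually.of_forall fun x ↦ by positivity)) hc.le

lemma intervalIntegrable_one_sub_rpow :
    IntervalIntegrable (fun w : ℝ ↦ (1 - w) ^ (-(1 / 2) : ℝ)) volume 0 1 := by
  have h := (intervalIntegral.intervalIntegrable_rpow' (a := 0) (b := 1)
    (r := -(1 / 2)) (by norm_num)).comp_sub_left 1
  simpa using h.symm

lemma integral_one_sub_rpow : ∫ w in (0 : ℝ)..1, (1 - w) ^ (-(1 / 2) : ℝ) = 2 := by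
  rw [intervalIntegral.integral_comp_sub_left (fun x : ℝ ↦ x ^ (-(1 / 2) : ℝ)) 1,
    integral_rpow (Or.inl (by norm_num))]
  norm_num

theorem integral_estimate_c (p : ℝ) (hp : 1 < p) :
    ∃ C : ℝ, 0 < C ∧ ∀ c : ℝ, 0 < c →
      ∫ w in (0 : ℝ)..1, ((c ^ 2 * w ^ 2 + 1) ^ (p / 2) * (1 - w) ^ ((1 : ℝ) / 2))⁻¹ ≤
        C / c := by
  have hK : 0 ≤ ∫ x : ℝ, (1 + x ^ 2) ^ (-p / 2) := integral_nonneg fun x ↦ by positivity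
  refine ⟨2 * (∫ x : ℝ, (1 + x ^ 2) ^ (-p / 2)) + 4, by linarith, fun c hc ↦ ?_⟩
  have hint₁ : IntervalIntegrable (fun w : ℝ ↦ 2 * (1 + (c * w) ^ 2) ^ (-p / 2)) volume 0 1 :=
    (((integrable_one_add_sq_rpow hp).comp_mul_left' hc.ne').const_mul 2).intervalIntegrable
  have hint₂ := intervalIntegrable_one_sub_rpow.const_mul (2 / c)
  calc _ ≤ ∫ w in (0 : ℝ)..1,
        (2 * (1 + (c * w) ^ 2) ^ (-p / 2) + 2 / c * (1 - w) ^ (-(1 / 2) : ℝ)) := by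
        rw [intervalIntegral.integral_of_le zero_le_one,
          intervalIntegral.integral_of_le zero_le_one]
        refine integral_mono_of_nonneg ?_ (hint₁.add hint₂).1 ?_
        all_goals
          filter_upwards [ae_restrict_mem measurableSet_Ioc] with w hw
        · have : 0 ≤ 1 - w := by linarith [hw.2]
          show (0 : ℝ) ≤ _
          positivity
        · exact inv_rpow_mul_rpow_le hp.le hc hw.1 hw.2
    _ = 2 * (∫ w in (0 : ℝ)..1, (1 + (c * w) ^ 2) ^ (-p / 2)) + 2 / c * 2 := by
        rw [intervalIntegral.integral_add hint₁ hint₂, intervalIntegral.integral_const_mul,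
          intervalIntegral.integral_const_mul, integral_one_sub_rpow]
    _ ≤ 2 * ((∫ x : ℝ, (1 + x ^ 2) ^ (-p / 2)) / c) + 2 / c * 2 := by
        gcongr
        exact integral_one_add_mul_sq_rpow_le hp hc
    _ = _ := by ring
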